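/- (Non-overlapping of resonances.) For every s = 1,…,d−1 there exist positive constants C̄_s and D̄_s, depending only on 𝔠, 𝔉, d, C_{s−1}, D_{s−1}, ε, δ_{s−1} and τ, such that the following holds: if C_s > C̄_s and D_s > D̄_s, then for any two distinct submodules M and M′ of ℤ^d of respective dimensions s and s′ with s′ ≤ s and M′ ⊄ M, one has E⁽ˢ⁾_M ∩ Z⁽ˢ′⁾_{M′} = ∅. -/

import Mathlib

/-- A positive definite symmetric bilinear form on `ℝ^d`. -/
structure PDForm (d : ℕ) where
  B : (Fin d → ℝ) →ₗ[ℝ] (Fin d → ℝ) →ₗ[ℝ] ℝ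
  symm : ∀ x y, B x y = B y x
  posdef : ∀ x, x ≠ 0 → 0 < B x x

namespace PDForm

variable {d : ℕ} (g : PDForm d)

/-- The inner product `⟨·,·⟩` associated with the form. -/
def inn (x y : Fin d → ℝ) : ℝ := g.B x y

/-- The norm `‖·‖` associated with the form. -/
noncomputable def nrm (x : Fin d → ℝ) : ℝ := Real.sqrt (g.inn x x)

/-- The Japanese bracket `⟨x⟩ = (1+‖x‖²)^{1/2}`. -/
noncomputable def jap (x : Fin d → ℝ) : ℝ := Real.sqrt (1 + g.inn x x)

end PDForm

/-- Cast of a lattice vector of `ℤ^d` into `ℝ^d`. -/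
def zc {d : ℕ} (k : Fin d → ℤ) : Fin d → ℝ := fun i => (k i : ℝ)

/-- `𝔠 := min{‖k‖² : k ∈ ℤ^d, k ≠ 0}`. -/
noncomputable def frakc {d : ℕ} (g : PDForm d) : ℝ :=
  sInf {x | ∃ k : Fin d → ℤ, k ≠ 0 ∧ x = (g.nrm (zc k)) ^ 2}

/-- Gram volume `√det(⟨u_i,u_j⟩)` of an `s`-tuple of vectors. -/
noncomputable def gvol {d s : ℕ} (g : PDForm d) (u : Fin s → (Fin d → ℝ)) : ℝ :=
  Real.sqrt (Matrix.det (Matrix.of fun i j => g.inn (u i) (u j)))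

/-- `𝔉`, the minimal Gram volume of parallelepipeds with linearly independent integer edges. -/
noncomputable def frakC {d : ℕ} (g : PDForm d) : ℝ :=
  sInf {x | ∃ (s : ℕ) (u : Fin s → (Fin d → ℤ)), 1 ≤ s ∧ s ≤ d ∧
    LinearIndependent ℝ (fun j => zc (u j)) ∧ x = gvol g (fun j => zc (u j))}

/-- A submodule of `ℤ^d` in the sense of the paper: `span_ℝ(M) ∩ ℤ^d = M`. -/
def IsSat {d : ℕ} (M : Submodule ℤ (Fin d → ℤ)) : Prop :=
  ∀ k : Fin d → ℤ, zc k ∈ Submodule.span ℝ (zc '' (M : Set (Fin d → ℤ))) → k ∈ M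

/-- The dimension (rank) of a submodule of `ℤ^d`. -/
noncomputable def zrank {d : ℕ} (M : Submodule ℤ (Fin d → ℤ)) : ℕ := Module.finrank ℤ M

/-- `ξ_k := ξ + κ + k/2`. -/
noncomputable def xik {d : ℕ} (κ : Fin d → ℝ) (ξ k : Fin d → ℤ) : Fin d → ℝ :=
  fun i => (ξ i : ℝ) + κ i + (k i : ℝ) / 2

/-- All the data entering the definition of the resonant zones. -/
structure ZoneData (d : ℕ) where
  g : PDForm d
  κ : Fin d → ℝ
  E : Set (Fin d → ℤ)
  δ : ℝ
  ε : ℝ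
  τ : ℝ
  Cs : ℕ → ℝ
  Ds : ℕ → ℝ

namespace ZoneData

variable {d : ℕ} (Z : ZoneData d)

/-- `δ_s := δ + s (d+τ+1) ε`. -/
noncomputable def δs (s : ℕ) : ℝ := Z.δ + s * ((d + Z.τ + 1) * Z.ε)

/-- The completely nonresonant zone `Z⁽⁰⁾`. -/
noncomputable def Z0 : Set (Fin d → ℤ) :=
  {ξ | ξ ∈ Z.E ∧ ∀ k : Fin d → ℤ, k ≠ 0 →
    Z.g.nrm (zc k) ≤ (Z.g.jap (xik Z.κ ξ k)) ^ Z.ε →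
    |Z.g.inn (xik Z.κ ξ k) (zc k)| >
      (Z.g.jap (xik Z.κ ξ k)) ^ Z.δ * (Z.g.nrm (zc k)) ^ (-Z.τ)}

/-- The resonant zone `Z⁽ˢ⁾_M`, union over linearly independent `s`-tuples in `M`
of the zones `Z_{k₁,…,k_s}`. -/
noncomputable def ZM (s : ℕ) (M : Submodule ℤ (Fin d → ℤ)) : Set (Fin d → ℤ) :=
  {ξ | ξ ∈ Z.E ∧ ∃ (hs : 0 < s) (k : Fin s → (Fin d → ℤ)),
    (∀ j, k j ∈ M) ∧ LinearIndependent ℝ (fun j => zc (k j)) ∧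
    ∀ j : Fin s,
      |Z.g.inn (xik Z.κ ξ (k ⟨0, hs⟩)) (zc (k j))| ≤
        Z.Cs j * (Z.g.jap (xik Z.κ ξ (k ⟨0, hs⟩))) ^ (Z.δs j) * (Z.g.nrm (zc (k j))) ^ (-Z.τ) ∧
      Z.g.nrm (zc (k j)) ≤ Z.Ds j * (Z.g.jap (xik Z.κ ξ (k ⟨0, hs⟩))) ^ Z.ε}

/-- The resonant block `B⁽ˢ⁾_M`. -/
noncomputable def BM (s : ℕ) (M : Submodule ℤ (Fin d → ℤ)) : Set (Fin d → ℤ) :=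
  Z.ZM s M \
    ⋃ (M' : Submodule ℤ (Fin d → ℤ)) (_ : IsSat M' ∧ zrank M' = s + 1), Z.ZM (s + 1) M'

/-- The extended block `E⁽ˢ⁾_M` (for `s ≥ 1`). -/
noncomputable def EM : ℕ → Submodule ℤ (Fin d → ℤ) → Set (Fin d → ℤ)
  | s, M =>
    {ξ | (∃ b ∈ Z.BM s M, ∃ m ∈ M, ξ = b + m) ∧ ξ ∈ Z.ZM s M ∧
      ∀ r, 1 ≤ r → r < s → ∀ M' : Submodule ℤ (Fin d → ℤ),
        IsSat M' → zrank M' = r → ξ ∉ EM r M'}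
  termination_by s => s

end ZoneData

/-- Conditions on the parameters `δ, ε, τ`. -/
def ParamsOK (d : ℕ) (δ ε τ : ℝ) : Prop :=
  1 ≤ d ∧ 0 < δ ∧ δ < 1 ∧ 0 < ε ∧ (d : ℝ) - 1 < τ ∧
    δ + d * ((d + τ + 1) * ε) < 1 ∧ ε * (τ + 1) ≤ δ

/-- Conditions `1 = C₀ < C₁ < ⋯ < C_{d-1}` and `1 = D₀ < D₁ < ⋯ < D_{d-1}`. -/
def SeqOK (d : ℕ) (Cs Ds : ℕ → ℝ) : Prop :=
  Cs 0 = 1 ∧ Ds 0 = 1 ∧ (∀ j, j + 2 ≤ d → Cs j < Cs (j + 1)) ∧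
    (∀ j, j + 2 ≤ d → Ds j < Ds (j + 1))



namespace PDForm

variable {d : ℕ} (g : PDForm d)

lemma inn_self_nonneg (x : Fin d → ℝ) : 0 ≤ g.inn x x := by
  by_cases hx : x = 0
  · simp [inn, hx]
  · exact (g.posdef x hx).le

lemma nrm_nonneg (x : Fin d → ℝ) : 0 ≤ g.nrm x := Real.sqrt_nonneg _

lemma nrm_sq (x : Fin d → ℝ) : g.nrm x ^ 2 = g.inn x x := Real.sq_sqrt (g.inn_self_nonneg x)

lemma inn_add_left (x y z : Fin d → ℝ) : g.inn (x + y) z = g.inn x z + g.inn y z := by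
  simp [inn]

lemma inn_smul_right (a : ℝ) (x y : Fin d → ℝ) : g.inn x (a • y) = a * g.inn x y := by
  simp [inn]

lemma inn_sum_right {ι : Type*} (t : Finset ι) (x : Fin d → ℝ) (f : ι → Fin d → ℝ) :
    g.inn x (∑ i ∈ t, f i) = ∑ i ∈ t, g.inn x (f i) := by
  simp [inn]

/-- The Cauchy-Schwarz inequality. -/
lemma abs_inn_le (x y : Fin d → ℝ) : |g.inn x y| ≤ g.nrm x * g.nrm y := by
  have h := LinearMap.BilinForm.apply_sq_le_of_symm g.B g.inn_self_nonneg ⟨g.symm⟩ x y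
  refine abs_le_of_sq_le_sq ?_ (mul_nonneg (g.nrm_nonneg x) (g.nrm_nonneg y))
  rw [mul_pow, nrm_sq, nrm_sq]
  exact h

lemma inn_add_self (x y : Fin d → ℝ) :
    g.inn (x + y) (x + y) = g.inn x x + 2 * g.inn x y + g.inn y y := by
  have := g.symm x y
  simp only [inn, map_add, LinearMap.add_apply]
  linarith

lemma nrm_add_le (x y : Fin d → ℝ) : g.nrm (x + y) ≤ g.nrm x + g.nrm y := by
  refine abs_le_of_sq_le_sq' ?_ (add_nonneg (g.nrm_nonneg x) (g.nrm_nonneg y)) |>.2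
  have := (abs_le.1 (g.abs_inn_le x y)).2
  rw [nrm_sq, inn_add_self, ← nrm_sq, ← nrm_sq]
  nlinarith

lemma nrm_smul (a : ℝ) (x : Fin d → ℝ) : g.nrm (a • x) = |a| * g.nrm x := by
  have : g.inn (a • x) (a • x) = a ^ 2 * g.inn x x := by
    simp only [inn, map_smul, LinearMap.smul_apply, smul_eq_mul]
    ring
  rw [nrm, this, Real.sqrt_mul (sq_nonneg a), Real.sqrt_sq_eq_abs, nrm]

lemma nrm_neg (x : Fin d → ℝ) : g.nrm (-x) = g.nrm x := by
  simpa using g.nrm_smul (-1) x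

lemma nrm_sub_le (x y : Fin d → ℝ) : g.nrm (x - y) ≤ g.nrm x + g.nrm y := by
  simpa [sub_eq_add_neg, nrm_neg] using g.nrm_add_le x (-y)

lemma nrm_zero : g.nrm 0 = 0 := by simp [nrm, inn]

lemma nrm_sum_le {ι : Type*} (t : Finset ι) (f : ι → Fin d → ℝ) :
    g.nrm (∑ i ∈ t, f i) ≤ ∑ i ∈ t, g.nrm (f i) :=
  Finset.le_sum_of_subadditive g.nrm g.nrm_zero.le g.nrm_add_le t f

lemma jap_sq (x : Fin d → ℝ) : g.jap x ^ 2 = 1 + g.nrm x ^ 2 := by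
  rw [nrm_sq, jap, Real.sq_sqrt]
  linarith [g.inn_self_nonneg x]

lemma one_le_jap (x : Fin d → ℝ) : 1 ≤ g.jap x := by
  rw [jap, Real.one_le_sqrt]
  linarith [g.inn_self_nonneg x]

lemma jap_add_le (x y : Fin d → ℝ) : g.jap (x + y) ≤ g.jap x + g.nrm y := by
  have hx := g.one_le_jap x
  have hy := g.nrm_nonneg y
  refine abs_le_of_sq_le_sq' ?_ (by linarith) |>.2
  have hle : g.nrm x ≤ g.jap x :=
    (abs_le_of_sq_le_sq' (by rw [jap_sq]; linarith) (by linarith)).2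
  have := (abs_le.1 (g.abs_inn_le x y)).2
  rw [jap_sq, nrm_sq, inn_add_self, ← nrm_sq, ← nrm_sq]
  nlinarith [g.jap_sq x, mul_le_mul_of_nonneg_right hle hy]

end PDForm

/-- The cast `zc` as a `ℤ`-linear map. -/
def zcLin (d : ℕ) : (Fin d → ℤ) →ₗ[ℤ] (Fin d → ℝ) where
  toFun := zc
  map_add' x y := by ext; simp [zc]
  map_smul' a x := by ext; simp [zc]

lemma zc_injective {d : ℕ} : Function.Injective (zc (d := d)) := fun x y h => by
  ext i
  simpa [zc] using congrFun h i

lemma zc_add {d : ℕ} (x y : Fin d → ℤ) : zc (x + y) = zc x + zc y := (zcLin d).map_add x y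

lemma zc_smul {d : ℕ} (a : ℤ) (x : Fin d → ℤ) : zc (a • x) = (a : ℝ) • zc x := by
  ext; simp [zc]

lemma zc_sum {d : ℕ} {ι : Type*} (t : Finset ι) (f : ι → Fin d → ℤ) :
    zc (∑ i ∈ t, f i) = ∑ i ∈ t, zc (f i) := map_sum (zcLin d) f t

lemma zc_eq_zero {d : ℕ} {x : Fin d → ℤ} : zc x = 0 ↔ x = 0 :=
  map_eq_zero_iff (zcLin d) zc_injective

lemma frakc_le {d : ℕ} (g : PDForm d) {k : Fin d → ℤ} (hk : k ≠ 0) :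
    frakc g ≤ g.nrm (zc k) ^ 2 :=
  csInf_le ⟨0, by rintro x ⟨k, -, rfl⟩; positivity⟩ ⟨k, hk, rfl⟩

lemma frakc_pos {d : ℕ} (hd : 1 ≤ d) (g : PDForm d) : 0 < frakc g := by
  have : Nonempty (Fin d) := ⟨⟨0, hd⟩⟩
  have hcont : Continuous fun x : Fin d → ℝ => g.inn x x := by
    have h : Continuous fun x : Fin d → ℝ => g.B.toContinuousBilinearMap x x := by fun_prop
    exact h
  obtain ⟨u, hu, hmin⟩ := (isCompact_sphere (0 : Fin d → ℝ) 1).exists_isMinOn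
    (NormedSpace.sphere_nonempty.2 zero_le_one) hcont.continuousOn
  have hu0 : u ≠ 0 := by
    rintro rfl
    simp at hu
  have hpos : 0 < g.inn u u := g.posdef u hu0
  refine hpos.trans_le (le_csInf ⟨_, fun _ => 1, ?_, rfl⟩ ?_)
  · exact fun h => one_ne_zero (congrFun h ⟨0, hd⟩)
  rintro x ⟨k, hk, rfl⟩
  have hk1 : 1 ≤ ‖zc k‖ := by
    obtain ⟨i, hi⟩ := Function.ne_iff.1 hk
    refine le_trans ?_ (norm_le_pi_norm (zc k) i)
    simp only [zc, Real.norm_eq_abs]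
    exact_mod_cast Int.one_le_abs hi
  have hmem : ‖zc k‖⁻¹ • zc k ∈ Metric.sphere (0 : Fin d → ℝ) 1 := by
    rw [mem_sphere_zero_iff_norm, norm_smul, norm_inv, norm_norm, inv_mul_cancel₀]
    positivity
  have h := isMinOn_iff.1 hmin _ hmem
  simp only [← g.nrm_sq (_ • _), g.nrm_smul, abs_inv, abs_norm, mul_pow] at h
  refine h.trans ?_
  have : (‖zc k‖⁻¹) ^ 2 ≤ 1 := pow_le_one₀ (by positivity) (inv_le_one_of_one_le₀ hk1)
  nlinarith [sq_nonneg (g.nrm (zc k))]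

/-- Dirichlet's theorem on simultaneous approximation. -/
lemma exists_simultaneous_approx {n : ℕ} (y : Fin n → ℝ) {Q : ℕ} (hQ : 0 < Q) :
    ∃ q : ℕ, 1 ≤ q ∧ q ≤ Q ^ n ∧ ∃ a : Fin n → ℤ, ∀ i, |q * y i - a i| ≤ 1 / Q := by
  have hQ' : (0 : ℝ) < Q := by exact_mod_cast hQ
  let f : ℕ → Fin n → ℕ := fun q i => ⌊Q * Int.fract (q * y i)⌋₊
  have hmaps : ∀ q ∈ Finset.range (Q ^ n + 1), f q ∈ Fintype.piFinset fun _ => Finset.range Q := by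
    intro q _
    rw [Fintype.mem_piFinset]
    intro i
    rw [Finset.mem_range, Nat.floor_lt (mul_nonneg hQ'.le (Int.fract_nonneg _))]
    nlinarith [Int.fract_lt_one (q * y i)]
  obtain ⟨q₁, h₁, q₂, h₂, hne, heq⟩ :=
    Finset.exists_ne_map_eq_of_card_lt_of_maps_to (by simp) hmaps
  wlog hlt : q₁ < q₂ generalizing q₁ q₂
  · exact this q₂ h₂ q₁ h₁ hne.symm heq.symm (by omega)
  refine ⟨q₂ - q₁, by omega, by simp at h₁ h₂; omega,
    fun i => ⌊q₂ * y i⌋ - ⌊q₁ * y i⌋, fun i => ?_⟩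
  have hi : f q₁ i = f q₂ i := congrFun heq i
  have e₁ := Nat.floor_le (mul_nonneg hQ'.le (Int.fract_nonneg (q₁ * y i)))
  have e₂ := Nat.floor_le (mul_nonneg hQ'.le (Int.fract_nonneg (q₂ * y i)))
  have e₃ := Nat.lt_floor_add_one (Q * Int.fract (q₁ * y i))
  have e₄ := Nat.lt_floor_add_one (Q * Int.fract (q₂ * y i))
  simp only [f] at hi
  rw [hi] at e₁ e₃
  rw [Nat.cast_sub hlt.le, le_div_iff₀ hQ', ← abs_of_pos hQ', ← abs_mul, abs_le]
  simp only [Int.fract] at e₁ e₂ e₃ e₄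
  push_cast
  constructor <;> nlinarith

/-- The coefficients of a real combination of independent lattice vectors are controlled by the norm
of the combination. -/
lemma abs_coeff_le {d n : ℕ} (g : PDForm d) {p D : ℝ} (hp : 0 < p)
    (hpk : ∀ k : Fin d → ℤ, k ≠ 0 → p ≤ g.nrm (zc k)) (k : Fin (n + 1) → Fin d → ℤ)
    (hli : LinearIndependent ℝ fun j => zc (k j)) (hD : ∀ j, g.nrm (zc (k j)) ≤ D)
    (x : Fin (n + 1) → ℝ) (j : Fin (n + 1)) :
    |x j| ≤ 2 / p * (3 * (n + 1) * D / p) ^ n * g.nrm (∑ i, x i • zc (k i)) := by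
  have hpD : p ≤ D := (hpk _ fun h => hli.ne_zero 0 (by simp [h, zc_eq_zero])).trans (hD 0)
  have hD0 : 0 < D := hp.trans_le hpD
  set S := ∑ i, x i • zc (k i) with hS
  have hSn := g.nrm_nonneg S
  by_cases hx : x j = 0
  · rw [hx, abs_zero]
    positivity
  set Q : ℕ := ⌈2 * (n + 1) * D / p⌉₊ with hQdef
  have hQle : 2 * (n + 1) * D / p ≤ Q := Nat.le_ceil _
  have hQpos' : (0 : ℝ) < Q := lt_of_lt_of_le (by positivity) hQle
  have hQpos : 0 < Q := by exact_mod_cast hQpos'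
  have hQup : (Q : ℝ) ≤ 3 * (n + 1) * D / p := by
    have h₁ : (Q : ℝ) < 2 * (n + 1) * D / p + 1 := Nat.ceil_lt_add_one (by positivity)
    have h₂ : 1 ≤ (n + 1) * D / p := by
      rw [le_div_iff₀ hp]
      nlinarith [mul_nonneg n.cast_nonneg hD0.le (α := ℝ)]
    have h₃ : 3 * (n + 1) * D / p = 2 * (n + 1) * D / p + (n + 1) * D / p := by ring
    linarith
  obtain ⟨q, hq1, hqQ, a, ha⟩ :=
    exists_simultaneous_approx (fun i => x (j.succAbove i) / x j) hQpos
  set u : Fin d → ℤ := (q : ℤ) • k j + ∑ i, a i • k (j.succAbove i) with hu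
  have hzu : zc u = (q : ℝ) • zc (k j) + ∑ i, (a i : ℝ) • zc (k (j.succAbove i)) := by
    rw [hu, zc_add, zc_smul, zc_sum]
    simp only [zc_smul, Int.cast_natCast]
  have hu0 : u ≠ 0 := by
    intro h0
    have hz : ∑ i, (j.insertNth (q : ℝ) (fun i => (a i : ℝ)) : Fin (n + 1) → ℝ) i • zc (k i)
        = 0 := by
      rw [Fin.sum_univ_succAbove _ j]
      simp only [Fin.insertNth_apply_same, Fin.insertNth_apply_succAbove]
      rw [← hzu, h0, zc_eq_zero]
    have := Fintype.linearIndependent_iff.1 hli _ hz j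
    simp only [Fin.insertNth_apply_same, Nat.cast_eq_zero] at this
    omega
  have hdecomp : zc u = ((q : ℝ) / x j) • S
      - ∑ i, ((q : ℝ) * (x (j.succAbove i) / x j) - a i) • zc (k (j.succAbove i)) := by
    rw [hzu, hS, Fin.sum_univ_succAbove _ j, smul_add, smul_smul, div_mul_cancel₀ _ hx,
      add_sub_assoc, Finset.smul_sum, ← Finset.sum_sub_distrib]
    congr 1
    refine Finset.sum_congr rfl fun i _ => ?_
    rw [smul_smul, ← sub_smul]
    congr 1
    ring
  have hrest : g.nrm (∑ i, ((q : ℝ) * (x (j.succAbove i) / x j) - a i) •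
      zc (k (j.succAbove i))) ≤ p / 2 := by
    refine (g.nrm_sum_le _ _).trans ((Finset.sum_le_card_nsmul _ _ (1 / Q * D) ?_).trans ?_)
    · intro i _
      rw [g.nrm_smul]
      exact mul_le_mul (ha i) (hD _) (g.nrm_nonneg _) (by positivity)
    · rw [Finset.card_univ, Fintype.card_fin, nsmul_eq_mul, ← mul_assoc, mul_one_div,
        div_mul_eq_mul_div, div_le_iff₀ hQpos']
      rw [div_le_iff₀ hp] at hQle
      linarith
  have hmain : p / 2 ≤ q / |x j| * g.nrm S := by
    have h := (hpk u hu0).trans (hdecomp ▸ g.nrm_sub_le _ _)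
    rw [g.nrm_smul, abs_div, Nat.abs_cast] at h
    linarith
  have hqle : (q : ℝ) ≤ (3 * (n + 1) * D / p) ^ n :=
    (by exact_mod_cast hqQ : (q : ℝ) ≤ (Q : ℝ) ^ n).trans (by gcongr)
  rw [div_mul_eq_mul_div, le_div_iff₀ (abs_pos.2 hx)] at hmain
  calc |x j| = 2 / p * (p / 2 * |x j|) := by field_simp
    _ ≤ 2 / p * (q * g.nrm S) := by gcongr
    _ ≤ 2 / p * ((3 * (n + 1) * D / p) ^ n * g.nrm S) := by gcongr
    _ = _ := by ring

lemma abs_inn_le_of_mem_span {d n : ℕ} (g : PDForm d) {p D α : ℝ} (hp : 0 < p)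
    (hpk : ∀ k : Fin d → ℤ, k ≠ 0 → p ≤ g.nrm (zc k)) (k : Fin (n + 1) → Fin d → ℤ)
    (hli : LinearIndependent ℝ fun j => zc (k j)) (hD : ∀ j, g.nrm (zc (k j)) ≤ D)
    {w v : Fin d → ℝ} (hw : ∀ j, |g.inn w (zc (k j))| ≤ α)
    (hv : v ∈ Submodule.span ℝ (Set.range fun j => zc (k j))) :
    |g.inn w v| ≤ (n + 1) * (2 / p * (3 * (n + 1) * D / p) ^ n) * α * g.nrm v := by
  obtain ⟨x, rfl⟩ := (Submodule.mem_span_range_iff_exists_fun ℝ).1 hv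
  rw [g.inn_sum_right]
  refine (Finset.abs_sum_le_sum_abs _ _).trans
    ((Finset.sum_le_card_nsmul _ _
      (2 / p * (3 * (n + 1) * D / p) ^ n * g.nrm (∑ i, x i • zc (k i)) * α) ?_).trans ?_)
  · intro j _
    rw [g.inn_smul_right, abs_mul]
    have hc := abs_coeff_le g hp hpk k hli hD x j
    exact mul_le_mul hc (hw j) (abs_nonneg _) ((abs_nonneg _).trans hc)
  · rw [Finset.card_univ, Fintype.card_fin, nsmul_eq_mul]
    push_cast
    exact le_of_eq (by ring)

lemma finrank_span_zc_image {d : ℕ} (M : Submodule ℤ (Fin d → ℤ)) :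
    Module.finrank ℝ (Submodule.span ℝ (zc '' (M : Set (Fin d → ℤ)))) = zrank M := by
  have himg : zc '' (M : Set (Fin d → ℤ)) = (M.map (zcLin d) : Set (Fin d → ℝ)) := by
    simp [Submodule.map_coe, zcLin]
  have hle : M.map (zcLin d) ≤ Submodule.span ℤ (Set.range (Pi.basisFun ℝ (Fin d))) := by
    rintro _ ⟨k, -, rfl⟩
    rw [Module.Basis.mem_span_iff_repr_mem]
    intro i
    exact ⟨k i, by simp [zcLin, zc]⟩
  have hdisc : DiscreteTopology (Submodule.span ℤ (M.map (zcLin d) : Set (Fin d → ℝ))) := by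
    rw [Submodule.span_eq]
    exact DiscreteTopology.of_subset
      (s := (Submodule.span ℤ (Set.range (Pi.basisFun ℝ (Fin d))) : Set (Fin d → ℝ)))
      (inferInstanceAs (DiscreteTopology
        (Submodule.span ℤ (Set.range (Pi.basisFun ℝ (Fin d)))))) hle
  have h := Real.finrank_eq_int_finrank_of_discrete hdisc
  rw [Set.finrank, Set.finrank, Submodule.span_eq] at h
  rw [himg, h, zrank]
  exact (Submodule.equivMapOfInjective (zcLin d) zc_injective M).finrank_eq.symm

lemma span_range_eq_of_zrank_eq {d s : ℕ} {M : Submodule ℤ (Fin d → ℤ)} (hM : zrank M = s)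
    {k : Fin s → Fin d → ℤ} (hk : ∀ j, k j ∈ M) (hli : LinearIndependent ℝ fun j => zc (k j)) :
    Submodule.span ℝ (Set.range fun j => zc (k j)) =
      Submodule.span ℝ (zc '' (M : Set (Fin d → ℤ))) := by
  refine Submodule.eq_of_le_of_finrank_eq (Submodule.span_mono ?_) ?_
  · rintro _ ⟨j, rfl⟩
    exact ⟨k j, hk j, rfl⟩
  · rw [finrank_span_eq_card hli, finrank_span_zc_image, hM, Fintype.card_fin]

/-- The lattice points in the real span of a family of lattice vectors. -/
def satSpan {d s : ℕ} (k : Fin s → Fin d → ℤ) : Submodule ℤ (Fin d → ℤ) :=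
  ((Submodule.span ℝ (Set.range fun j => zc (k j))).restrictScalars ℤ).comap (zcLin d)

lemma mem_satSpan {d s : ℕ} {k : Fin s → Fin d → ℤ} {x : Fin d → ℤ} :
    x ∈ satSpan k ↔ zc x ∈ Submodule.span ℝ (Set.range fun j => zc (k j)) := Iff.rfl

lemma mem_satSpan_self {d s : ℕ} (k : Fin s → Fin d → ℤ) (j : Fin s) : k j ∈ satSpan k :=
  mem_satSpan.2 (Submodule.subset_span ⟨j, rfl⟩)

lemma span_zc_image_satSpan {d s : ℕ} (k : Fin s → Fin d → ℤ) :
    Submodule.span ℝ (zc '' (satSpan k : Set (Fin d → ℤ))) =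
      Submodule.span ℝ (Set.range fun j => zc (k j)) := by
  refine le_antisymm (Submodule.span_le.2 ?_) (Submodule.span_mono ?_)
  · rintro _ ⟨x, hx, rfl⟩
    exact mem_satSpan.1 hx
  · rintro _ ⟨j, rfl⟩
    exact ⟨k j, mem_satSpan_self k j, rfl⟩

lemma isSat_satSpan {d s : ℕ} (k : Fin s → Fin d → ℤ) : IsSat (satSpan k) := fun x hx => by
  rwa [span_zc_image_satSpan] at hx

lemma zrank_satSpan {d s : ℕ} {k : Fin s → Fin d → ℤ}
    (hli : LinearIndependent ℝ fun j => zc (k j)) : zrank (satSpan k) = s := by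
  rw [← finrank_span_zc_image, span_zc_image_satSpan, finrank_span_eq_card hli, Fintype.card_fin]

/-- Absorption of a sublinear term. -/
lemma le_mul_of_le_add_rpow {A a x y : ℝ} (hA : 1 ≤ A) (ha0 : 0 ≤ a) (ha1 : a < 1) (hx : 1 ≤ x)
    (hy : 1 ≤ y) (h : y ≤ A * x + A * y ^ a) : y ≤ (2 * A) ^ (1 / (1 - a)) * x := by
  have h1a : 0 < 1 - a := by linarith
  have hexp : 1 ≤ 1 / (1 - a) := by rw [le_div_iff₀ h1a]; linarith
  rcases le_total (y ^ a) x with hyx | hyx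
  · have : 2 * A ≤ (2 * A) ^ (1 / (1 - a)) := Real.self_le_rpow_of_one_le (by linarith) hexp
    nlinarith
  · have hy0 : 0 < y := by linarith
    have hpow : y ^ (1 - a) ≤ 2 * A := by
      rw [Real.rpow_sub hy0, Real.rpow_one, div_le_iff₀ (by positivity)]
      nlinarith
    have hle : y ≤ (2 * A) ^ (1 / (1 - a)) := by
      rw [one_div, Real.le_rpow_inv_iff_of_pos hy0.le (by linarith) h1a]
      exact hpow
    exact hle.trans (le_mul_of_one_le_right (by positivity) hx)

lemma rpow_le_mul_rpow {K x y e : ℝ} (hK : 1 ≤ K) (hx : 1 ≤ x) (hy : 1 ≤ y) (he0 : 0 ≤ e)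
    (he1 : e ≤ 1) (h : y ≤ K * x) : y ^ e ≤ K * x ^ e := by
  calc y ^ e ≤ (K * x) ^ e := Real.rpow_le_rpow (by linarith) h he0
    _ = K ^ e * x ^ e := Real.mul_rpow (by linarith) (by linarith)
    _ ≤ K ^ (1 : ℝ) * x ^ e := by gcongr
    _ = K * x ^ e := by rw [Real.rpow_one]

lemma nrm_le_of_abs_inn_le {d : ℕ} (g : PDForm d) {w w' v e : Fin d → ℝ} {A A' : ℝ} (hA : 0 ≤ A)
    (hA' : 0 ≤ A') (hw : |g.inn w v| ≤ A * g.nrm v) (hw' : |g.inn w' v| ≤ A' * g.nrm v)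
    (h : w' = w + v + e) : g.nrm v ≤ A + A' + g.nrm e := by
  have he := g.abs_inn_le e v
  have hinn : g.inn w' v = g.inn w v + g.inn v v + g.inn e v := by
    rw [h, g.inn_add_left, g.inn_add_left]
  rw [← g.nrm_sq] at hinn
  have hv := g.nrm_nonneg v
  have he' := g.nrm_nonneg e
  rw [abs_le] at hw hw' he
  by_contra! hlt
  nlinarith

lemma xik_add {d : ℕ} (κ : Fin d → ℝ) (b m k h : Fin d → ℤ) :
    xik κ (b + m) h = xik κ b k + zc m + (1 / 2 : ℝ) • (zc h - zc k) := by
  ext i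
  simp only [xik, zc, Pi.add_apply, Pi.smul_apply, Pi.sub_apply, smul_eq_mul, Int.cast_add]
  ring

lemma nrm_half_sub_le {d : ℕ} (g : PDForm d) (x y : Fin d → ℝ) :
    g.nrm ((1 / 2 : ℝ) • (x - y)) ≤ (g.nrm x + g.nrm y) / 2 := by
  rw [g.nrm_smul, abs_of_pos (by norm_num)]
  linarith [g.nrm_sub_le x y]

/-- A vector near resonance with a full tuple of short vectors of `M` is almost orthogonal to
`M`. -/
lemma abs_inn_le_of_resonant {d n : ℕ} (g : PDForm d) {p C D ε τ δ J : ℝ} (hp : 0 < p)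
    (hC : 0 ≤ C) (hτ : 0 ≤ τ) (hJ : 1 ≤ J)
    (hpk : ∀ k : Fin d → ℤ, k ≠ 0 → p ≤ g.nrm (zc k)) {M : Submodule ℤ (Fin d → ℤ)}
    (hM : zrank M = n + 1) {k : Fin (n + 1) → Fin d → ℤ} (hkM : ∀ j, k j ∈ M)
    (hli : LinearIndependent ℝ fun j => zc (k j)) {w : Fin d → ℝ}
    (hw : ∀ j, |g.inn w (zc (k j))| ≤ C * J ^ δ * g.nrm (zc (k j)) ^ (-τ))
    (hk : ∀ j, g.nrm (zc (k j)) ≤ D * J ^ ε) {m : Fin d → ℤ} (hm : m ∈ M) :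
    |g.inn w (zc m)| ≤ (n + 1) * (2 / p * (3 * (n + 1) * D / p) ^ n) * (C * p ^ (-τ)) *
      J ^ (δ + n * ε) * g.nrm (zc m) := by
  have hJ0 : 0 < J := by linarith
  have hmem : zc m ∈ Submodule.span ℝ (Set.range fun j => zc (k j)) := by
    rw [span_range_eq_of_zrank_eq hM hkM hli]
    exact Submodule.subset_span ⟨m, hm, rfl⟩
  have hα : ∀ j, |g.inn w (zc (k j))| ≤ C * J ^ δ * p ^ (-τ) := fun j => by
    have hkj : k j ≠ 0 := fun h => hli.ne_zero j (by simp [h, zc_eq_zero])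
    refine (hw j).trans (mul_le_mul_of_nonneg_left ?_ (by positivity))
    exact Real.rpow_le_rpow_of_nonpos hp (hpk _ hkj) (by linarith)
  refine (abs_inn_le_of_mem_span g hp hpk k hli hk hα hmem).trans (le_of_eq ?_)
  have e₁ : 3 * ((n : ℝ) + 1) * (D * J ^ ε) / p = (3 * (n + 1) * D / p) * J ^ ε := by ring
  have e₂ : (J ^ ε) ^ n = J ^ (n * ε) := by
    rw [← Real.rpow_natCast, ← Real.rpow_mul hJ0.le, mul_comm]
  rw [e₁, mul_pow, e₂, Real.rpow_add hJ0]
  ring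

lemma exists_notMem_of_not_le {d s : ℕ} {M M' : Submodule ℤ (Fin d → ℤ)} (hM : IsSat M)
    (hM' : zrank M' = s) (hle : ¬ M' ≤ M) {k : Fin s → Fin d → ℤ} (hk : ∀ j, k j ∈ M')
    (hli : LinearIndependent ℝ fun j => zc (k j)) : ∃ j, k j ∉ M := by
  by_contra! hall
  refine hle fun x hx => hM x ?_
  have hxs : zc x ∈ Submodule.span ℝ (Set.range fun j => zc (k j)) := by
    rw [span_range_eq_of_zrank_eq hM' hk hli]
    exact Submodule.subset_span ⟨x, hx, rfl⟩
  refine Submodule.span_mono ?_ hxs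
  rintro _ ⟨j, rfl⟩
  exact ⟨k j, hall j, rfl⟩

namespace ZoneData

variable {d : ℕ} (Z : ZoneData d)

/-- If a point of `Z⁽ˢ⁾_M` is moreover resonant with a vector outside `M`, it does not belong to the
block `B⁽ˢ⁾_M`. -/
lemma notMem_BM {s : ℕ} {M : Submodule ℤ (Fin d → ℤ)} (hM : IsSat M) {b : Fin d → ℤ}
    (hbE : b ∈ Z.E) (hs : 0 < s) {k : Fin s → Fin d → ℤ} (hkM : ∀ j, k j ∈ M)
    (hli : LinearIndependent ℝ fun j => zc (k j))
    (hk : ∀ j : Fin s, |Z.g.inn (xik Z.κ b (k ⟨0, hs⟩)) (zc (k j))| ≤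
        Z.Cs j * (Z.g.jap (xik Z.κ b (k ⟨0, hs⟩))) ^ (Z.δs j) * (Z.g.nrm (zc (k j))) ^ (-Z.τ) ∧
      Z.g.nrm (zc (k j)) ≤ Z.Ds j * (Z.g.jap (xik Z.κ b (k ⟨0, hs⟩))) ^ Z.ε)
    {q : Fin d → ℤ} (hq : q ∉ M)
    (hq₁ : |Z.g.inn (xik Z.κ b (k ⟨0, hs⟩)) (zc q)| ≤
        Z.Cs s * (Z.g.jap (xik Z.κ b (k ⟨0, hs⟩))) ^ (Z.δs s) * (Z.g.nrm (zc q)) ^ (-Z.τ))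
    (hq₂ : Z.g.nrm (zc q) ≤ Z.Ds s * (Z.g.jap (xik Z.κ b (k ⟨0, hs⟩))) ^ Z.ε) :
    b ∉ Z.BM s M := by
  rintro ⟨-, hb⟩
  let k' : Fin (s + 1) → Fin d → ℤ := Fin.snoc k q
  have hk'c : ∀ j : Fin s, k' j.castSucc = k j := fun j => Fin.snoc_castSucc ..
  have hk'l : k' (Fin.last s) = q := Fin.snoc_last ..
  have hk'0 : k' ⟨0, s.succ_pos⟩ = k ⟨0, hs⟩ := hk'c ⟨0, hs⟩
  have hli' : LinearIndependent ℝ fun j => zc (k' j) := by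
    have hsnoc : (fun j => zc (k' j)) = Fin.snoc (fun j => zc (k j)) (zc q) := by
      funext j
      refine Fin.lastCases ?_ (fun i => ?_) j <;> simp [k']
    rw [hsnoc, linearIndependent_finSnoc]
    refine ⟨hli, fun hmem => hq (hM q (Submodule.span_mono ?_ hmem))⟩
    rintro _ ⟨j, rfl⟩
    exact ⟨k j, hkM j, rfl⟩
  refine hb (Set.mem_iUnion₂.2 ⟨satSpan k', ⟨isSat_satSpan k', zrank_satSpan hli'⟩, hbE,
    s.succ_pos, k', mem_satSpan_self k', hli', fun j => ?_⟩)
  rw [hk'0]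
  refine Fin.lastCases ?_ (fun i => ?_) j
  · rw [hk'l]
    exact ⟨hq₁, hq₂⟩
  · rw [hk'c]
    exact hk i

lemma δs_mono (h : 0 ≤ (d + Z.τ + 1) * Z.ε) {i j : ℕ} (hij : i ≤ j) : Z.δs i ≤ Z.δs j := by
  have : (i : ℝ) ≤ j := by exact_mod_cast hij
  unfold δs
  gcongr

/-- The first vector of a resonant tuple is at most `⟨ξ_k⟩^ε`, and all of the tuple satisfies the
weakest of the resonance conditions. -/
lemma resonant_bounds {n s : ℕ} (hsn : s ≤ n + 1) (hstep : 0 ≤ (d + Z.τ + 1) * Z.ε) {C D : ℝ}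
    (hC : 0 ≤ C) (hCs : ∀ j ≤ n, Z.Cs j ≤ C) (hDs : ∀ j ≤ n, Z.Ds j ≤ D) {J : ℝ} (hJ : 1 ≤ J)
    {w : Fin d → ℝ} {k : Fin s → Fin d → ℤ}
    (hk : ∀ j : Fin s, |Z.g.inn w (zc (k j))| ≤
        Z.Cs j * J ^ (Z.δs j) * (Z.g.nrm (zc (k j))) ^ (-Z.τ) ∧
      Z.g.nrm (zc (k j)) ≤ Z.Ds j * J ^ Z.ε) (j : Fin s) :
    |Z.g.inn w (zc (k j))| ≤ C * J ^ (Z.δs n) * (Z.g.nrm (zc (k j))) ^ (-Z.τ) ∧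
      Z.g.nrm (zc (k j)) ≤ D * J ^ Z.ε := by
  have hj : (j : ℕ) ≤ n := by have := j.isLt; omega
  have hN := Z.g.nrm_nonneg (zc (k j))
  have hδ := Z.δs_mono hstep hj
  have := hCs j hj
  have := hDs j hj
  refine ⟨(hk j).1.trans ?_, (hk j).2.trans ?_⟩ <;> gcongr

end ZoneData

lemma EM_inter_ZM_eq_empty {d n : ℕ} {δ ε τ p C D : ℝ} (hpar : ParamsOK d δ ε τ)
    (hnd : n + 1 ≤ d - 1) (hp : 0 < p) (hC : 1 ≤ C) (hD : 1 ≤ D) :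
    ∃ Cb Db : ℝ, 0 < Cb ∧ 0 < Db ∧
      ∀ (g : PDForm d) (κ : Fin d → ℝ) (E : Set (Fin d → ℤ)) (Cs Ds : ℕ → ℝ),
        (∀ k : Fin d → ℤ, k ≠ 0 → p ≤ g.nrm (zc k)) →
        (∀ j ≤ n, Cs j ≤ C) → (∀ j ≤ n, Ds j ≤ D) → Ds 0 = 1 →
        Cb < Cs (n + 1) → Db < Ds (n + 1) →
        ∀ (M M' : Submodule ℤ (Fin d → ℤ)) (s' : ℕ), IsSat M → zrank M = n + 1 →
          zrank M' = s' → s' ≤ n + 1 → ¬ M' ≤ M →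
          (ZoneData.mk g κ E δ ε τ Cs Ds).EM (n + 1) M ∩
            (ZoneData.mk g κ E δ ε τ Cs Ds).ZM s' M' = ∅ := by
  obtain ⟨hd1, hδ0, hδ1, hε, hτd, hsum, hετ⟩ := hpar
  have hd1' : (1 : ℝ) ≤ d := by exact_mod_cast hd1
  have hτ : 0 < τ := by linarith
  have hnd' : (n : ℝ) + 2 ≤ d := by exact_mod_cast (by omega : n + 2 ≤ d)
  have hn0 : (0 : ℝ) ≤ n := n.cast_nonneg
  have hstep : 0 < (d + τ + 1) * ε := by positivity
  set σ : ℝ := δ + n * ((d + τ + 1) * ε) with hσ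
  set a : ℝ := σ + n * ε with ha
  have hnε : 0 ≤ n * ε := by positivity
  have hσ0 : 0 < σ := by positivity
  have ha0 : 0 < a := by positivity
  have hεa : ε ≤ a := by
    have : 0 ≤ n * ((d + τ + 1) * ε) := by positivity
    nlinarith
  have ha_step : a + ε * (τ + 1) ≤ σ + (d + τ + 1) * ε := by
    rw [ha]
    nlinarith
  have hσ_step : σ + (d + τ + 1) * ε < 1 := by
    rw [hσ]
    nlinarith
  have ha1 : a < 1 := by nlinarith
  set K₁ : ℝ := (n + 1) * (2 / p * (3 * (n + 1) * D / p) ^ n) * (C * p ^ (-τ)) with hK₁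
  have hK₁0 : 0 ≤ K₁ := by positivity
  set K : ℝ := (2 * 2) ^ (1 / (1 - a)) * (2 * (K₁ + 3)) ^ (1 / (1 - a)) with hK
  have hexp : 0 ≤ 1 / (1 - a) := by
    have : 0 < 1 - a := by linarith
    positivity
  have hK₂1 : 1 ≤ ((2 : ℝ) * 2) ^ (1 / (1 - a)) := Real.one_le_rpow (by norm_num) hexp
  have hK₃1 : 1 ≤ (2 * (K₁ + 3)) ^ (1 / (1 - a)) := Real.one_le_rpow (by linarith) hexp
  have hK1 : 1 ≤ K := one_le_mul_of_one_le_of_one_le hK₂1 hK₃1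
  refine ⟨C * K + (K₁ + 2) * (1 + K) * (D * K) ^ (τ + 1), D * K, by positivity, by positivity, ?_⟩
  intro g κ E Cs Ds hpk hCs hDs hDs0 hCb hDb M M' s' hsat hM hM' hs' hle
  set Z : ZoneData d := ⟨g, κ, E, δ, ε, τ, Cs, Ds⟩ with hZ
  refine Set.eq_empty_iff_forall_notMem.2 ?_
  rintro ξ ⟨hξE, hξE', hs'0, q, hqM', hqli, hq⟩
  rw [ZoneData.EM] at hξE
  obtain ⟨⟨b, hbB, m, hmM, rfl⟩, ⟨_, _, h, hhM, hhli, hh⟩, _⟩ := hξE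
  obtain ⟨hbE, hn1, k, hkM, hkli, hk⟩ := hbB.1
  obtain ⟨j, hj⟩ := exists_notMem_of_not_le hsat hM' hle hqM' hqli
  have hC0 : 0 ≤ C := by linarith
  set k₀ := k ⟨0, hn1⟩
  set h₀ := h ⟨0, hn1⟩
  set q₀ := q ⟨0, hs'0⟩
  set β := g.jap (xik κ b k₀)
  set Y := g.jap (xik κ (b + m) h₀)
  set W := g.jap (xik κ (b + m) q₀)
  have hβ1 : 1 ≤ β := g.one_le_jap _
  have hY1 : 1 ≤ Y := g.one_le_jap _
  have hW1 : 1 ≤ W := g.one_le_jap _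
  have hkb := Z.resonant_bounds le_rfl hstep.le hC0 hCs hDs hβ1 hk
  have hhb := Z.resonant_bounds le_rfl hstep.le hC0 hCs hDs hY1 hh
  have hqb := Z.resonant_bounds hs' hstep.le hC0 hCs hDs hW1 hq j
  have hpow : ∀ {J : ℝ}, 1 ≤ J → J ^ ε ≤ J ^ a := fun hJ =>
    Real.rpow_le_rpow_of_exponent_le hJ hεa
  have hk₀ : g.nrm (zc k₀) ≤ β ^ a := by
    have h₁ : g.nrm (zc k₀) ≤ Ds 0 * β ^ ε := (hk ⟨0, hn1⟩).2
    rw [hDs0, one_mul] at h₁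
    exact h₁.trans (hpow hβ1)
  have hh₀ : g.nrm (zc h₀) ≤ Y ^ a := by
    have h₁ : g.nrm (zc h₀) ≤ Ds 0 * Y ^ ε := (hh ⟨0, hn1⟩).2
    rw [hDs0, one_mul] at h₁
    exact h₁.trans (hpow hY1)
  have hq₀ : g.nrm (zc q₀) ≤ W ^ a := by
    have h₁ : g.nrm (zc q₀) ≤ Ds 0 * W ^ ε := (hq ⟨0, hs'0⟩).2
    rw [hDs0, one_mul] at h₁
    exact h₁.trans (hpow hW1)
  have hβa : β ^ a ≤ β := (Real.rpow_le_rpow_of_exponent_le hβ1 ha1.le).trans_eq (Real.rpow_one β)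
  have hYa : Y ^ a ≤ Y := (Real.rpow_le_rpow_of_exponent_le hY1 ha1.le).trans_eq (Real.rpow_one Y)
  have hβa0 : 0 < β ^ a := by positivity
  have hYa0 : 0 < Y ^ a := by positivity
  have hWa0 : 0 < W ^ a := by positivity
  -- the displacement `m` is small compared with `⟨b⟩` and `⟨b + m⟩`
  have hm : g.nrm (zc m) ≤ (K₁ + 1) * (β ^ a + Y ^ a) := by
    have hb₁ := abs_inn_le_of_resonant g hp hC0 hτ.le hβ1 hpk hM hkM hkli
      (fun j => (hkb j).1) (fun j => (hkb j).2) hmM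
    have hb₂ := abs_inn_le_of_resonant g hp hC0 hτ.le hY1 hpk hM hhM hhli
      (fun j => (hhb j).1) (fun j => (hhb j).2) hmM
    have hb₃ := nrm_le_of_abs_inn_le g (by positivity) (by positivity) hb₁ hb₂
      (xik_add κ b m k₀ h₀)
    have hb₄ : g.nrm (zc m) ≤ K₁ * β ^ a + K₁ * Y ^ a + g.nrm ((1 / 2 : ℝ) • (zc h₀ - zc k₀)) :=
      hb₃
    linarith [nrm_half_sub_le g (zc h₀) (zc k₀)]
  -- the brackets at `b` and at `b + m` are comparable
  have hYβ : Y ≤ (2 * (K₁ + 3)) ^ (1 / (1 - a)) * β := by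
    refine le_mul_of_le_add_rpow (by linarith) ha0.le ha1 hβ1 hY1 ?_
    have h₁ : Y ≤ β + g.nrm (zc m + (1 / 2 : ℝ) • (zc h₀ - zc k₀)) := by
      have h₂ := g.jap_add_le (xik κ b k₀) (zc m + (1 / 2 : ℝ) • (zc h₀ - zc k₀))
      rwa [← add_assoc, ← xik_add] at h₂
    have h₂ := g.nrm_add_le (zc m) ((1 / 2 : ℝ) • (zc h₀ - zc k₀))
    have h₃ := nrm_half_sub_le g (zc h₀) (zc k₀)
    have h₄ := mul_le_mul_of_nonneg_left hβa (by linarith : 0 ≤ K₁ + 2)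
    linarith
  have hWY : W ≤ (2 * 2) ^ (1 / (1 - a)) * Y := by
    refine le_mul_of_le_add_rpow (by norm_num) ha0.le ha1 hY1 hW1 ?_
    have h₁ : W ≤ Y + g.nrm ((1 / 2 : ℝ) • (zc q₀ - zc h₀)) := by
      have h₂ := g.jap_add_le (xik κ (b + m) h₀) ((1 / 2 : ℝ) • (zc q₀ - zc h₀))
      have h₃ := xik_add κ (b + m) 0 h₀ q₀
      rw [zc_eq_zero.2 rfl, add_zero, add_zero] at h₃
      rwa [← h₃] at h₂
    have h₂ := nrm_half_sub_le g (zc q₀) (zc h₀)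
    linarith
  have hWK : W ≤ K * β := by
    rw [hK, mul_assoc]
    exact hWY.trans (by gcongr)
  have hYK : Y ≤ K * β := by
    rw [hK, mul_assoc]
    exact hYβ.trans (le_mul_of_one_le_left (by positivity) hK₂1)
  have hWε := rpow_le_mul_rpow hK1 hβ1 hW1 hε.le (by linarith) hWK
  have hqD : g.nrm (zc (q j)) ≤ D * K * β ^ ε := by
    refine hqb.2.trans ?_
    rw [mul_assoc]
    exact mul_le_mul_of_nonneg_left hWε (by linarith)
  refine Z.notMem_BM hsat hbE hn1 hkM hkli hk hj ?_ ?_ hbB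
  · have hz : g.nrm (zc m + (1 / 2 : ℝ) • (zc q₀ - zc k₀)) ≤ (K₁ + 2) * (1 + K) * β ^ a := by
      have h₁ := g.nrm_add_le (zc m) ((1 / 2 : ℝ) • (zc q₀ - zc k₀))
      have h₂ := nrm_half_sub_le g (zc q₀) (zc k₀)
      have h₃ := rpow_le_mul_rpow hK1 hβ1 hY1 ha0.le ha1.le hYK
      have h₄ := rpow_le_mul_rpow hK1 hβ1 hW1 ha0.le ha1.le hWK
      have h₅ := mul_le_mul_of_nonneg_left h₃ (by linarith : 0 ≤ K₁ + 1)
      have h₆ : 0 ≤ K * β ^ a := by positivity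
      linarith
    have hqj0 : 0 < g.nrm (zc (q j)) :=
      hp.trans_le (hpk _ fun h0 => hqli.ne_zero j (by simp [h0, zc_eq_zero]))
    set N := g.nrm (zc (q j))
    have hN : N ≤ (D * K) ^ (τ + 1) * β ^ (ε * (τ + 1)) * N ^ (-τ) := by
      calc N = N ^ (τ + 1) * N ^ (-τ) := by
            rw [← Real.rpow_add hqj0]; simp
        _ ≤ (D * K * β ^ ε) ^ (τ + 1) * N ^ (-τ) := by gcongr
        _ = _ := by
            rw [Real.mul_rpow (by positivity) (by positivity), ← Real.rpow_mul (by positivity)]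
    have hσs : Z.δs (n + 1) = σ + (d + τ + 1) * ε := by
      simp only [ZoneData.δs, hZ, hσ]
      push_cast
      ring
    set θ := Z.δs (n + 1)
    have hres : |g.inn (xik κ (b + m) q₀) (zc (q j))| ≤ C * K * β ^ θ * N ^ (-τ) := by
      have h₁ : W ^ σ ≤ K * β ^ θ :=
        (rpow_le_mul_rpow hK1 hβ1 hW1 hσ0.le (by linarith) hWK).trans
          (mul_le_mul_of_nonneg_left
            (Real.rpow_le_rpow_of_exponent_le hβ1 (by linarith)) (by linarith))
      calc |g.inn (xik κ (b + m) q₀) (zc (q j))| ≤ C * W ^ σ * N ^ (-τ) := hqb.1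
        _ ≤ C * (K * β ^ θ) * N ^ (-τ) := by gcongr
        _ = _ := by ring
    have hdisp : g.nrm (zc m + (1 / 2 : ℝ) • (zc q₀ - zc k₀)) * N ≤
        (K₁ + 2) * (1 + K) * (D * K) ^ (τ + 1) * β ^ θ * N ^ (-τ) := by
      calc _ ≤ ((K₁ + 2) * (1 + K) * β ^ a) *
            ((D * K) ^ (τ + 1) * β ^ (ε * (τ + 1)) * N ^ (-τ)) := by gcongr
        _ = (K₁ + 2) * (1 + K) * (D * K) ^ (τ + 1) * β ^ (a + ε * (τ + 1)) * N ^ (-τ) := by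
            rw [Real.rpow_add (by positivity) a (ε * (τ + 1))]; ring
        _ ≤ _ := by
            gcongr
            linarith
    have hsplit : g.inn (xik κ b k₀) (zc (q j)) = g.inn (xik κ (b + m) q₀) (zc (q j)) -
        g.inn (zc m + (1 / 2 : ℝ) • (zc q₀ - zc k₀)) (zc (q j)) := by
      rw [xik_add κ b m k₀ q₀, add_assoc, g.inn_add_left]
      ring
    calc |g.inn (xik κ b k₀) (zc (q j))|
        ≤ C * K * β ^ θ * N ^ (-τ) +
          (K₁ + 2) * (1 + K) * (D * K) ^ (τ + 1) * β ^ θ * N ^ (-τ) := by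
          rw [hsplit]
          exact (abs_sub _ _).trans (add_le_add hres ((g.abs_inn_le _ _).trans hdisp))
      _ = (C * K + (K₁ + 2) * (1 + K) * (D * K) ^ (τ + 1)) * β ^ θ * N ^ (-τ) := by ring
      _ ≤ Cs (n + 1) * β ^ θ * N ^ (-τ) := by gcongr
  · exact hqD.trans (mul_le_mul_of_nonneg_right hDb.le (by positivity))

lemma le_of_forall_lt_succ {d : ℕ} {f : ℕ → ℝ} (hf : ∀ j, j + 2 ≤ d → f j < f (j + 1)) {i n : ℕ}
    (hin : i ≤ n) (hn : n + 1 ≤ d) : f i ≤ f n := by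
  induction n, hin using Nat.le_induction with
  | base => exact le_rfl
  | succ n _ ih => exact (ih (by omega)).trans (hf n (by omega)).le

/-- non-overlapping of resonances. For every `1 ≤ s ≤ d-1` there are
positive constants `C̄_s, D̄_s`, depending only on `𝔠, 𝔉, d, C_{s-1}, D_{s-1}, ε, δ_{s-1}, τ`,
such that if `C_s > C̄_s` and `D_s > D̄_s` then for distinct submodules `M, M'` of dimensions
`s, s'` with `s' ≤ s` and `M' ⊄ M` one has `E⁽ˢ⁾_M ∩ Z⁽ˢ'⁾_{M'} = ∅`. -/
theorem statement3 (d s : ℕ) (δ ε τ : ℝ) (hpar : ParamsOK d δ ε τ)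
    (hs1 : 1 ≤ s) (hsd : s ≤ d - 1) :
    ∃ Cbar Dbar : ℝ → ℝ → ℝ → ℝ → ℝ,
      (∀ a b c e, 0 < Cbar a b c e ∧ 0 < Dbar a b c e) ∧
      ∀ (g : PDForm d) (κ : Fin d → ℝ) (E : Set (Fin d → ℤ)) (Cs Ds : ℕ → ℝ),
        SeqOK d Cs Ds →
        Cbar (frakc g) (frakC g) (Cs (s - 1)) (Ds (s - 1)) < Cs s →
        Dbar (frakc g) (frakC g) (Cs (s - 1)) (Ds (s - 1)) < Ds s →
        let Z : ZoneData d := ⟨g, κ, E, δ, ε, τ, Cs, Ds⟩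
        ∀ (M M' : Submodule ℤ (Fin d → ℤ)) (s' : ℕ),
          IsSat M → IsSat M' → zrank M = s → zrank M' = s' →
          1 ≤ s' → s' ≤ s → M ≠ M' → ¬ M' ≤ M →
          Z.EM s M ∩ Z.ZM s' M' = ∅ := by
  obtain ⟨n, rfl⟩ : ∃ n, s = n + 1 := ⟨s - 1, by omega⟩
  have key : ∀ a C D : ℝ, ∃ Cb Db : ℝ, 0 < Cb ∧ 0 < Db ∧ (0 < a → 1 ≤ C → 1 ≤ D →
      ∀ (g : PDForm d) (κ : Fin d → ℝ) (E : Set (Fin d → ℤ)) (Cs Ds : ℕ → ℝ),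
        (∀ k : Fin d → ℤ, k ≠ 0 → √a ≤ g.nrm (zc k)) →
        (∀ j ≤ n, Cs j ≤ C) → (∀ j ≤ n, Ds j ≤ D) → Ds 0 = 1 →
        Cb < Cs (n + 1) → Db < Ds (n + 1) →
        ∀ (M M' : Submodule ℤ (Fin d → ℤ)) (s' : ℕ), IsSat M → zrank M = n + 1 →
          zrank M' = s' → s' ≤ n + 1 → ¬ M' ≤ M →
          (ZoneData.mk g κ E δ ε τ Cs Ds).EM (n + 1) M ∩
            (ZoneData.mk g κ E δ ε τ Cs Ds).ZM s' M' = ∅) := by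
    intro a C D
    by_cases h : 0 < a ∧ 1 ≤ C ∧ 1 ≤ D
    · obtain ⟨Cb, Db, hCb, hDb, H⟩ :=
        EM_inter_ZM_eq_empty hpar hsd (Real.sqrt_pos.2 h.1) h.2.1 h.2.2
      exact ⟨Cb, Db, hCb, hDb, fun _ _ _ => H⟩
    · exact ⟨1, 1, one_pos, one_pos, fun h₁ h₂ h₃ => absurd ⟨h₁, h₂, h₃⟩ h⟩
  choose Cb Db hCb hDb H using key
  refine ⟨fun a _ C D => Cb a C D, fun a _ C D => Db a C D,
    fun a _ C D => ⟨hCb a C D, hDb a C D⟩, ?_⟩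
  intro g κ E Cs Ds ⟨hC0, hD0, hCs, hDs⟩ hC hD Z M M' s' hsat _ hM hM' _ hs' _ hle
  have hCn : ∀ j ≤ n, Cs j ≤ Cs n := fun j hj => le_of_forall_lt_succ hCs hj (by omega)
  have hDn : ∀ j ≤ n, Ds j ≤ Ds n := fun j hj => le_of_forall_lt_succ hDs hj (by omega)
  exact H (frakc g) (Cs n) (Ds n) (frakc_pos hpar.1 g) (hC0 ▸ hCn 0 n.zero_le)
    (hD0 ▸ hDn 0 n.zero_le) g κ E Cs Ds
    (fun k hk => Real.sqrt_le_iff.2 ⟨g.nrm_nonneg _, frakc_le g hk⟩) hCn hDn hD0 hC hD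
    M M' s' hsat hM hM' hs' hle
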